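/- For every integer n ≥ 2 there exists a constant C > 0 such that for every tuple f = (f₁,…,fₙ) with each f_k ∈ C_c^∞(ℝⁿ), setting g = div f = Σ_{k=1}^n ∂f_k/∂x_k, and every Φ ∈ C_c^∞(ℝⁿ), one has |∫_{ℝⁿ} f₁(x)Φ(x) dx| ≤ C (‖f‖_{L¹(ℝⁿ)} ‖∇Φ‖_{Lⁿ(ℝⁿ)} + ‖g‖_{L¹(ℝⁿ)} ‖Φ‖_{Lⁿ(ℝⁿ)}). -/

import Mathlib

open MeasureTheory Real Topology

noncomputable section

/-- `L^p` norm (w.r.t. Lebesgue measure) of a real function on `ℝⁿ`. -/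
def lpNormEuc {n : ℕ} (p : ℝ) (f : (Fin n → ℝ) → ℝ) : ℝ :=
  (∫ x : Fin n → ℝ, |f x| ^ p) ^ (1 / p)

open Set
open scoped ENNReal

lemma holderConjugate_natCast_add_one {m : ℕ} (hm : 1 ≤ m) :
    ((m : ℝ) + 1).HolderConjugate (((m : ℝ) + 1) / m) := by
  have hm0 : (0 : ℝ) < m := by exact_mod_cast hm
  rw [Real.holderConjugate_iff]
  constructor
  · linarith
  · field_simp
    ring

lemma volume_unitCube {m : ℕ} : volume (Icc (0 : Fin m → ℝ) 1) = 1 := by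
  simp [Real.volume_Icc_pi]

/-- The average over the rescaled unit cube is controlled by the `Lᵖ` norm with `p = m + 1`. -/
lemma setLIntegral_unitCube_comp_add_smul_le {m : ℕ} (hm : 1 ≤ m) {h : (Fin m → ℝ) → ℝ≥0∞}
    (hh : Measurable h) (y : Fin m → ℝ) {r : ℝ} (hr : 0 < r) :
    ∫⁻ z in Icc (0 : Fin m → ℝ) 1, h (y + r • z) ≤
      ENNReal.ofReal (r ^ (-(m : ℝ) / (m + 1))) *
        (∫⁻ x, h x ^ ((m : ℝ) + 1)) ^ (1 / ((m : ℝ) + 1)) := by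
  have hmeas : Measurable fun z : Fin m → ℝ => h (y + r • z) := by fun_prop
  have h1 := ENNReal.lintegral_mul_le_Lp_mul_Lq (volume.restrict (Icc (0 : Fin m → ℝ) 1))
    (holderConjugate_natCast_add_one hm) hmeas.aemeasurable
    (measurable_const (a := (1 : ℝ≥0∞))).aemeasurable
  have h2 : ∫⁻ z : Fin m → ℝ, h (y + r • z) ^ ((m : ℝ) + 1) =
      ENNReal.ofReal (r ^ (-(m : ℝ))) * ∫⁻ x, h x ^ ((m : ℝ) + 1) := by
    have e1 := lintegral_map (μ := (volume : Measure (Fin m → ℝ)))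
      (f := fun z => h (y + z) ^ ((m : ℝ) + 1)) (g := fun z => r • z)
      (by fun_prop) (by fun_prop)
    rw [← e1, Measure.map_addHaar_smul _ hr.ne', lintegral_smul_measure,
      lintegral_add_left_eq_self (fun z => h z ^ ((m : ℝ) + 1)) y]
    simp [Real.rpow_neg hr.le, abs_of_pos hr]
  calc ∫⁻ z in Icc (0 : Fin m → ℝ) 1, h (y + r • z)
      ≤ (∫⁻ z in Icc (0 : Fin m → ℝ) 1, h (y + r • z) ^ ((m : ℝ) + 1)) ^ (1 / ((m : ℝ) + 1)) := by
        simpa [volume_unitCube] using h1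
    _ ≤ (∫⁻ z, h (y + r • z) ^ ((m : ℝ) + 1)) ^ (1 / ((m : ℝ) + 1)) := by
        gcongr
        exact Measure.restrict_le_self
    _ = _ := by
        rw [h2, ENNReal.mul_rpow_of_nonneg _ _ (by positivity),
          ENNReal.ofReal_rpow_of_nonneg (by positivity) (by positivity), ← Real.rpow_mul hr.le]
        congr 3
        ring

lemma lintegral_Ioc_rpow {m : ℕ} {ε : ℝ} (hε : 0 < ε) :
    ∫⁻ r in Ioc 0 ε, ENNReal.ofReal (r ^ (-(m : ℝ) / (m + 1))) =
      (m + 1) * ENNReal.ofReal (ε ^ (1 / ((m : ℝ) + 1))) := by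
  have hlt : (-1 : ℝ) < -(m : ℝ) / (m + 1) := by
    rw [lt_div_iff₀ (by positivity)]
    linarith
  rw [← ofReal_integral_eq_lintegral_ofReal, ← intervalIntegral.integral_of_le hε.le,
    integral_rpow (Or.inl hlt)]
  · have e : -(m : ℝ) / (m + 1) + 1 = 1 / (m + 1) := by field_simp; ring
    have : ((m : ℝ≥0∞) + 1) = ENNReal.ofReal ((m : ℝ) + 1) := by
      rw [ENNReal.ofReal_add (by positivity) (by positivity)]; simp
    rw [e, this, ← ENNReal.ofReal_mul (by positivity), Real.zero_rpow (by positivity)]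
    congr 1
    field_simp
    ring
  · exact (intervalIntegrable_iff_integrableOn_Ioc_of_le hε.le).1
      (intervalIntegral.intervalIntegrable_rpow' hlt)
  · filter_upwards [ae_restrict_mem measurableSet_Ioc] with r hr
    exact Real.rpow_nonneg hr.1.le _

lemma enorm_sub_le_lintegral_fderiv {m : ℕ} {φ : (Fin m → ℝ) → ℝ} (hφ : ContDiff ℝ 1 φ)
    {D : (Fin m → ℝ) → ℝ≥0∞} (hD : ∀ k y, ‖fderiv ℝ φ y (Pi.single k 1)‖ₑ ≤ D y)
    (y : Fin m → ℝ) {z : Fin m → ℝ} (hz : z ∈ Icc (0 : Fin m → ℝ) 1) {ε : ℝ} (hε : 0 < ε) :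
    ‖φ y - φ (y + ε • z)‖ₑ ≤ ∫⁻ r in Ioc 0 ε, m * D (y + r • z) := by
  have hd : ∀ r ∈ uIcc 0 ε, HasDerivAt (fun r : ℝ => φ (y + r • z)) (fderiv ℝ φ (y + r • z) z) r := by
    intro r _
    have h1 : HasDerivAt (fun r : ℝ => y + r • z) z r := by
      simpa using ((hasDerivAt_id r).smul_const z).const_add y
    exact ((hφ.differentiable one_ne_zero _).hasFDerivAt).comp_hasDerivAt r h1
  have hc : Continuous fun r : ℝ => fderiv ℝ φ (y + r • z) z := by
    have := hφ.continuous_fderiv one_ne_zero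
    fun_prop
  have h := intervalIntegral.integral_eq_sub_of_hasDerivAt hd (hc.intervalIntegrable _ _)
  simp only [zero_smul, add_zero] at h
  rw [enorm_sub_rev, ← h, intervalIntegral.integral_of_le hε.le]
  refine (enorm_integral_le_lintegral_enorm _).trans (lintegral_mono fun r => ?_)
  have hzs : z = ∑ k, z k • (Pi.single k 1 : Fin m → ℝ) := by
    rw [← pi_eq_sum_univ' z]
  simp only
  conv_lhs => rw [hzs, map_sum]
  refine (enorm_sum_le _ _).trans ?_
  calc ∑ k, ‖fderiv ℝ φ (y + r • ∑ k, z k • (Pi.single k 1 : Fin m → ℝ)) (z k • Pi.single k 1)‖ₑ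
      ≤ ∑ k : Fin m, D (y + r • z) := by
        rw [← hzs]
        refine Finset.sum_le_sum fun k _ => ?_
        rw [map_smul, smul_eq_mul, enorm_mul]
        calc _ ≤ 1 * D (y + r • z) := by
              gcongr
              · rw [Real.enorm_eq_ofReal (hz.1 k)]
                exact ENNReal.ofReal_le_one.2 (hz.2 k)
              · exact hD k _
          _ = _ := one_mul _
    _ = _ := by simp

lemma HasCompactSupport.comp_prodMk_left {X Y : Type*} [TopologicalSpace X] [TopologicalSpace Y]
    [T2Space Y] {f : X × Y → ℝ} (hf : HasCompactSupport f) (x : X) :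
    HasCompactSupport fun y => f (x, y) := by
  refine HasCompactSupport.intro (hf.isCompact.image continuous_snd) fun y hy => ?_
  by_contra h
  exact hy ⟨(x, y), subset_tsupport _ h, rfl⟩

lemma HasCompactSupport.comp_prodMk_right {X Y : Type*} [TopologicalSpace X] [TopologicalSpace Y]
    [T2Space X] {f : X × Y → ℝ} (hf : HasCompactSupport f) (y : Y) :
    HasCompactSupport fun x => f (x, y) := by
  refine HasCompactSupport.intro (hf.isCompact.image continuous_fst) fun x hx => ?_
  by_contra h
  exact hx ⟨(x, y), subset_tsupport _ h, rfl⟩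

lemma continuous_fderiv_const_apply {E : Type*} [NormedAddCommGroup E]
    [NormedSpace ℝ E] {f : E → ℝ} (hf : ContDiff ℝ 1 f) (v : E) :
    Continuous fun x => fderiv ℝ f x v :=
  (hf.continuous_fderiv one_ne_zero).clm_apply continuous_const

lemma fderiv_comp_prodMk_left {E F : Type*} [NormedAddCommGroup E] [NormedSpace ℝ E]
    [NormedAddCommGroup F] [NormedSpace ℝ F] {f : E × F → ℝ} (hf : ContDiff ℝ 1 f)
    (x : E) (y v : F) :
    fderiv ℝ (fun y => f (x, y)) y v = fderiv ℝ f (x, y) (0, v) := by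
  have h := (hf.differentiable one_ne_zero (x, y)).hasFDerivAt.comp y (hasFDerivAt_prodMk_right x y)
  have h' := h.fderiv
  simp only [Function.comp_def] at h'
  rw [h']
  simp

lemma deriv_comp_prodMk_right {F : Type*} [NormedAddCommGroup F] [NormedSpace ℝ F]
    {f : ℝ × F → ℝ} (hf : ContDiff ℝ 1 f) (s : ℝ) (y : F) :
    deriv (fun s => f (s, y)) s = fderiv ℝ f (s, y) (1, 0) := by
  have h := (hf.differentiable one_ne_zero (s, y)).hasFDerivAt.comp_hasDerivAt s
    ((hasDerivAt_id s).prodMk (hasDerivAt_const s y))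
  exact h.deriv

section Slices

variable {m : ℕ}

/-- The divergence of the vector field `(F₀, F)` on `ℝ × ℝᵐ`. -/
def prodDiv (F₀ : ℝ × (Fin m → ℝ) → ℝ) (F : Fin m → ℝ × (Fin m → ℝ) → ℝ)
    (p : ℝ × (Fin m → ℝ)) : ℝ :=
  fderiv ℝ F₀ p (1, 0) + ∑ k, fderiv ℝ (F k) p (0, Pi.single k 1)

lemma integral_fderiv_slice_mul {F₀ : ℝ × (Fin m → ℝ) → ℝ} {F : Fin m → ℝ × (Fin m → ℝ) → ℝ}
    (hF₀ : ContDiff ℝ 1 F₀) (hF₀c : HasCompactSupport F₀)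
    (hF : ∀ k, ContDiff ℝ 1 (F k)) (hFc : ∀ k, HasCompactSupport (F k))
    {φ : (Fin m → ℝ) → ℝ} (hφ : ContDiff ℝ 1 φ) (s : ℝ) :
    ∫ y, fderiv ℝ F₀ (s, y) (1, 0) * φ y =
      ∫ y, (prodDiv F₀ F (s, y) * φ y +
        ∑ k, F k (s, y) * fderiv ℝ φ y (Pi.single k 1)) := by
  have c1 : ∀ k, Continuous fun y => fderiv ℝ (F k) (s, y) (0, Pi.single k 1) := fun k =>
    (continuous_fderiv_const_apply (hF k) _).comp (by fun_prop)
  have c0 : Continuous fun y => fderiv ℝ F₀ (s, y) (1, 0) :=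
    (continuous_fderiv_const_apply hF₀ _).comp (by fun_prop)
  have cφ : ∀ k, Continuous fun y => fderiv ℝ φ y (Pi.single k 1) := fun k =>
    continuous_fderiv_const_apply hφ _
  have cF : ∀ k, Continuous fun y => F k (s, y) := fun k => (hF k).continuous.comp (by fun_prop)
  have i1 : ∀ k, Integrable fun y => fderiv ℝ (F k) (s, y) (0, Pi.single k 1) * φ y := fun k =>
    ((c1 k).mul hφ.continuous).integrable_of_hasCompactSupport
      ((((hFc k).fderiv_apply (𝕜 := ℝ) _).comp_prodMk_left s).mul_right)
  have i2 : ∀ k, Integrable fun y => F k (s, y) * fderiv ℝ φ y (Pi.single k 1) := fun k =>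
    ((cF k).mul (cφ k)).integrable_of_hasCompactSupport ((hFc k).comp_prodMk_left s).mul_right
  have i3 : ∀ k, Integrable fun y => F k (s, y) * φ y := fun k =>
    ((cF k).mul hφ.continuous).integrable_of_hasCompactSupport
      ((hFc k).comp_prodMk_left s).mul_right
  have i0 : Integrable fun y => fderiv ℝ F₀ (s, y) (1, 0) * φ y :=
    (c0.mul hφ.continuous).integrable_of_hasCompactSupport
      (((hF₀c.fderiv_apply (𝕜 := ℝ) _).comp_prodMk_left s).mul_right)
  have ibp : ∀ k, ∫ y, F k (s, y) * fderiv ℝ φ y (Pi.single k 1) =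
      -∫ y, fderiv ℝ (F k) (s, y) (0, Pi.single k 1) * φ y := by
    intro k
    have h := integral_mul_fderiv_eq_neg_fderiv_mul_of_integrable (μ := volume)
      (f := fun y => F k (s, y)) (g := φ) (v := Pi.single k 1)
      (by simpa only [fderiv_comp_prodMk_left (hF k)] using i1 k) (i2 k) (i3 k)
      (fun y _ => (((hF k).comp (contDiff_prodMk_right s)).differentiable one_ne_zero) y)
      (fun y _ => hφ.differentiable one_ne_zero y)
    simpa only [fderiv_comp_prodMk_left (hF k)] using h
  have e : ∀ y, prodDiv F₀ F (s, y) * φ y + ∑ k, F k (s, y) * fderiv ℝ φ y (Pi.single k 1) =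
      fderiv ℝ F₀ (s, y) (1, 0) * φ y +
        ∑ k, (fderiv ℝ (F k) (s, y) (0, Pi.single k 1) * φ y +
          F k (s, y) * fderiv ℝ φ y (Pi.single k 1)) := by
    intro y
    rw [prodDiv, Finset.sum_add_distrib, add_mul, Finset.sum_mul]
    ring
  simp_rw [e]
  have i12 : ∀ k, Integrable fun y => fderiv ℝ (F k) (s, y) (0, Pi.single k 1) * φ y +
      F k (s, y) * fderiv ℝ φ y (Pi.single k 1) := fun k => (i1 k).add (i2 k)
  rw [integral_add i0 (integrable_finsetSum _ fun k _ => i12 k),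
    integral_finsetSum _ fun k _ => i12 k]
  have : ∀ k, ∫ y, (fderiv ℝ (F k) (s, y) (0, Pi.single k 1) * φ y +
          F k (s, y) * fderiv ℝ φ y (Pi.single k 1)) = 0 := by
    intro k
    rw [integral_add (i1 k) (i2 k), ibp k, add_neg_cancel]
  simp [this]

lemma enorm_integral_slice_mul_le {F₀ : ℝ × (Fin m → ℝ) → ℝ} {F : Fin m → ℝ × (Fin m → ℝ) → ℝ}
    (hF₀ : ContDiff ℝ 1 F₀) (hF₀c : HasCompactSupport F₀)
    (hF : ∀ k, ContDiff ℝ 1 (F k)) (hFc : ∀ k, HasCompactSupport (F k))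
    {φ : (Fin m → ℝ) → ℝ} (hφ : ContDiff ℝ 1 φ) {D : (Fin m → ℝ) → ℝ≥0∞}
    (hD : ∀ k y, ‖fderiv ℝ φ y (Pi.single k 1)‖ₑ ≤ D y) (t : ℝ) :
    ‖∫ y, F₀ (t, y) * φ y‖ₑ ≤
      ∫⁻ s, ∫⁻ y, (‖prodDiv F₀ F (s, y)‖ₑ * ‖φ y‖ₑ + (∑ k, ‖F k (s, y)‖ₑ) * D y) := by
  have hslice : ∀ y, F₀ (t, y) = -∫ s in Ioi t, fderiv ℝ F₀ (s, y) (1, 0) := by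
    intro y
    have h := HasCompactSupport.integral_Ioi_deriv_eq
      (hF₀.comp (contDiff_prodMk_left y)) (hF₀c.comp_prodMk_right y) t
    simp only [Function.comp_def, deriv_comp_prodMk_right hF₀] at h
    rw [h, neg_neg]
  have hint : Integrable (fun p : (Fin m → ℝ) × ℝ => fderiv ℝ F₀ (p.2, p.1) (1, 0) * φ p.1)
      (volume.prod volume) := by
    refine Continuous.integrable_of_hasCompactSupport ?_ ?_
    · exact ((continuous_fderiv_const_apply hF₀ (1, 0)).comp continuous_swap).mul
        (hφ.continuous.comp continuous_fst)
    · exact ((hF₀c.fderiv_apply (𝕜 := ℝ) (1, 0)).comp_homeomorph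
        (Homeomorph.prodComm (Fin m → ℝ) ℝ)).mul_right
  have hswap : ∫ y, F₀ (t, y) * φ y =
      -∫ s in Ioi t, ∫ y, fderiv ℝ F₀ (s, y) (1, 0) * φ y := by
    rw [← integral_integral_swap, ← integral_neg]
    · congr 1 with y
      rw [hslice y, neg_mul, integral_mul_const]
    · refine hint.mono_measure ?_
      exact Measure.prod_mono le_rfl Measure.restrict_le_self
  rw [hswap, enorm_neg]
  refine (enorm_integral_le_lintegral_enorm _).trans ?_
  refine (lintegral_mono' Measure.restrict_le_self le_rfl).trans (lintegral_mono fun s => ?_)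
  simp only
  rw [integral_fderiv_slice_mul hF₀ hF₀c hF hFc hφ]
  refine (enorm_integral_le_lintegral_enorm _).trans (lintegral_mono fun y => ?_)
  refine (enorm_add_le _ _).trans (add_le_add (enorm_mul _ _).le ?_)
  refine (enorm_sum_le _ _).trans ?_
  rw [Finset.sum_mul]
  refine Finset.sum_le_sum fun k _ => ?_
  rw [enorm_mul]
  gcongr
  exact hD k y

end Slices

section SliceEstimate

variable {m : ℕ}

lemma lintegral_unitCube_enorm_sub_le (hm : 1 ≤ m) {φ : (Fin m → ℝ) → ℝ} (hφ : ContDiff ℝ 1 φ)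
    {D : (Fin m → ℝ) → ℝ≥0∞} (hDm : Measurable D)
    (hD : ∀ k y, ‖fderiv ℝ φ y (Pi.single k 1)‖ₑ ≤ D y) (y : Fin m → ℝ) {ε : ℝ} (hε : 0 < ε) :
    ∫⁻ z in Icc (0 : Fin m → ℝ) 1, ‖φ y - φ (y + ε • z)‖ₑ ≤
      m * ((m + 1) * ENNReal.ofReal (ε ^ (1 / ((m : ℝ) + 1)))) *
        (∫⁻ x, D x ^ ((m : ℝ) + 1)) ^ (1 / ((m : ℝ) + 1)) := by
  calc ∫⁻ z in Icc (0 : Fin m → ℝ) 1, ‖φ y - φ (y + ε • z)‖ₑ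
      ≤ ∫⁻ z in Icc (0 : Fin m → ℝ) 1, ∫⁻ r in Ioc 0 ε, m * D (y + r • z) :=
        setLIntegral_mono' measurableSet_Icc fun z hz =>
          enorm_sub_le_lintegral_fderiv hφ hD y hz hε
    _ = ∫⁻ r in Ioc 0 ε, m * ∫⁻ z in Icc (0 : Fin m → ℝ) 1, D (y + r • z) := by
        rw [lintegral_lintegral_swap (by unfold Function.uncurry; fun_prop)]
        congr 1 with r
        rw [lintegral_const_mul _ (by fun_prop)]
    _ ≤ ∫⁻ r in Ioc 0 ε, m * (ENNReal.ofReal (r ^ (-(m : ℝ) / (m + 1))) *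
          (∫⁻ x, D x ^ ((m : ℝ) + 1)) ^ (1 / ((m : ℝ) + 1))) :=
        setLIntegral_mono' measurableSet_Ioc fun r hr => by
          gcongr
          exact setLIntegral_unitCube_comp_add_smul_le hm hDm y hr.1
    _ = _ := by
        rw [lintegral_const_mul _ (by fun_prop), lintegral_mul_const _ (by fun_prop),
          lintegral_Ioc_rpow hε]
        ring

lemma enorm_integral_slice_mul_le_of_scale (hm : 1 ≤ m) {F₀ : ℝ × (Fin m → ℝ) → ℝ}
    {F : Fin m → ℝ × (Fin m → ℝ) → ℝ}
    (hF₀ : ContDiff ℝ 1 F₀) (hF₀c : HasCompactSupport F₀)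
    (hF : ∀ k, ContDiff ℝ 1 (F k)) (hFc : ∀ k, HasCompactSupport (F k))
    {φ : (Fin m → ℝ) → ℝ} (hφ : ContDiff ℝ 1 φ)
    {D : (Fin m → ℝ) → ℝ≥0∞} (hDm : Measurable D)
    (hD : ∀ k y, ‖fderiv ℝ φ y (Pi.single k 1)‖ₑ ≤ D y) (t : ℝ) {ε : ℝ} (hε : 0 < ε) :
    ‖∫ y, F₀ (t, y) * φ y‖ₑ ≤
      (∫⁻ y, ‖F₀ (t, y)‖ₑ) * (m * ((m + 1) * ENNReal.ofReal (ε ^ (1 / ((m : ℝ) + 1)))) *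
        (∫⁻ x, D x ^ ((m : ℝ) + 1)) ^ (1 / ((m : ℝ) + 1))) +
      ((∫⁻ s, ∫⁻ y, ‖prodDiv F₀ F (s, y)‖ₑ) *
        (ENNReal.ofReal (ε ^ (-(m : ℝ) / (m + 1))) *
          (∫⁻ x, ‖φ x‖ₑ ^ ((m : ℝ) + 1)) ^ (1 / ((m : ℝ) + 1))) +
      (∫⁻ s, ∫⁻ y, ∑ k, ‖F k (s, y)‖ₑ) *
        (ENNReal.ofReal (ε ^ (-(m : ℝ) / (m + 1))) *
          (∫⁻ x, D x ^ ((m : ℝ) + 1)) ^ (1 / ((m : ℝ) + 1)))) := by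
  have mφ : Measurable φ := hφ.continuous.measurable
  have mF₀ : Measurable F₀ := hF₀.continuous.measurable
  have mF : ∀ k, Measurable (F k) := fun k => (hF k).continuous.measurable
  have mG : Measurable (prodDiv F₀ F) := by
    have h0 := continuous_fderiv_const_apply hF₀ (1, 0)
    have h1 := fun k => continuous_fderiv_const_apply (hF k) (0, Pi.single k 1)
    unfold prodDiv
    fun_prop
  have icF₀ : Continuous fun y => F₀ (t, y) := hF₀.continuous.comp (by fun_prop)
  have hshift : ∀ z, ContDiff ℝ 1 fun y => φ (y + ε • z) := fun z => by fun_prop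
  have hz : ∀ z, ‖∫ y, F₀ (t, y) * φ y‖ₑ ≤
      (∫⁻ y, ‖F₀ (t, y)‖ₑ * ‖φ y - φ (y + ε • z)‖ₑ) +
      ∫⁻ s, ∫⁻ y, (‖prodDiv F₀ F (s, y)‖ₑ * ‖φ (y + ε • z)‖ₑ +
        (∑ k, ‖F k (s, y)‖ₑ) * D (y + ε • z)) := by
    intro z
    have hsplit : ∫ y, F₀ (t, y) * φ y = (∫ y, F₀ (t, y) * (φ y - φ (y + ε • z))) +
        ∫ y, F₀ (t, y) * φ (y + ε • z) := by
      rw [← integral_add]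
      · congr 1 with y
        ring
      · exact (icF₀.mul (hφ.continuous.sub (hshift z).continuous)).integrable_of_hasCompactSupport
          (hF₀c.comp_prodMk_left t).mul_right
      · exact (icF₀.mul (hshift z).continuous).integrable_of_hasCompactSupport
          (hF₀c.comp_prodMk_left t).mul_right
    rw [hsplit]
    refine (enorm_add_le _ _).trans (add_le_add ?_ ?_)
    · exact (enorm_integral_le_lintegral_enorm _).trans
        (lintegral_mono fun y => (enorm_mul _ _).le)
    · refine enorm_integral_slice_mul_le hF₀ hF₀c hF hFc (hshift z)
        (D := fun y => D (y + ε • z)) (fun k y => ?_) t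
      rw [fderiv_comp_add_right (f := φ) (ε • z)]
      exact hD k _
  have hsep : ∀ A B : ℝ≥0∞,
      ∫⁻ s, ∫⁻ y, (‖prodDiv F₀ F (s, y)‖ₑ * A + (∑ k, ‖F k (s, y)‖ₑ) * B) =
      (∫⁻ s, ∫⁻ y, ‖prodDiv F₀ F (s, y)‖ₑ) * A + (∫⁻ s, ∫⁻ y, ∑ k, ‖F k (s, y)‖ₑ) * B := by
    intro A B
    rw [← lintegral_mul_const _ (by fun_prop), ← lintegral_mul_const _ (by fun_prop),
      ← lintegral_add_left (by fun_prop)]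
    congr 1 with s
    rw [lintegral_add_left (by fun_prop), lintegral_mul_const _ (by fun_prop),
      lintegral_mul_const _ (by fun_prop)]
  calc ‖∫ y, F₀ (t, y) * φ y‖ₑ
      = ∫⁻ z in Icc (0 : Fin m → ℝ) 1, ‖∫ y, F₀ (t, y) * φ y‖ₑ := by simp [volume_unitCube]
    _ ≤ ∫⁻ z in Icc (0 : Fin m → ℝ) 1, ((∫⁻ y, ‖F₀ (t, y)‖ₑ * ‖φ y - φ (y + ε • z)‖ₑ) +
          ∫⁻ s, ∫⁻ y, (‖prodDiv F₀ F (s, y)‖ₑ * ‖φ (y + ε • z)‖ₑ +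
            (∑ k, ‖F k (s, y)‖ₑ) * D (y + ε • z))) := lintegral_mono hz
    _ = (∫⁻ y, ‖F₀ (t, y)‖ₑ * ∫⁻ z in Icc (0 : Fin m → ℝ) 1, ‖φ y - φ (y + ε • z)‖ₑ) +
          ∫⁻ s, ∫⁻ y, (‖prodDiv F₀ F (s, y)‖ₑ *
              (∫⁻ z in Icc (0 : Fin m → ℝ) 1, ‖φ (y + ε • z)‖ₑ) +
            (∑ k, ‖F k (s, y)‖ₑ) * ∫⁻ z in Icc (0 : Fin m → ℝ) 1, D (y + ε • z)) := by
        rw [lintegral_add_left (by fun_prop)]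
        congr 1
        · rw [lintegral_lintegral_swap (by unfold Function.uncurry; fun_prop)]
          congr 1 with y
          rw [lintegral_const_mul _ (by fun_prop)]
        · rw [lintegral_lintegral_swap (by unfold Function.uncurry; fun_prop)]
          congr 1 with s
          rw [lintegral_lintegral_swap (by unfold Function.uncurry; fun_prop)]
          congr 1 with y
          rw [lintegral_add_left (by fun_prop), lintegral_const_mul _ (by fun_prop),
            lintegral_const_mul _ (by fun_prop)]
    _ ≤ (∫⁻ y, ‖F₀ (t, y)‖ₑ * (m * ((m + 1) * ENNReal.ofReal (ε ^ (1 / ((m : ℝ) + 1)))) *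
          (∫⁻ x, D x ^ ((m : ℝ) + 1)) ^ (1 / ((m : ℝ) + 1)))) +
          ∫⁻ s, ∫⁻ y, (‖prodDiv F₀ F (s, y)‖ₑ *
            (ENNReal.ofReal (ε ^ (-(m : ℝ) / (m + 1))) *
              (∫⁻ x, ‖φ x‖ₑ ^ ((m : ℝ) + 1)) ^ (1 / ((m : ℝ) + 1))) +
            (∑ k, ‖F k (s, y)‖ₑ) * (ENNReal.ofReal (ε ^ (-(m : ℝ) / (m + 1))) *
              (∫⁻ x, D x ^ ((m : ℝ) + 1)) ^ (1 / ((m : ℝ) + 1)))) := by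
        gcongr with y s y
        · exact lintegral_unitCube_enorm_sub_le hm hφ hDm hD y hε
        · exact setLIntegral_unitCube_comp_add_smul_le hm (h := fun y => ‖φ y‖ₑ)
            (by fun_prop) y hε
        · exact setLIntegral_unitCube_comp_add_smul_le hm hDm y hε
    _ = _ := by
        rw [lintegral_mul_const _ (by fun_prop), hsep]

end SliceEstimate

section Optimization

variable {m : ℕ}

lemma ENNReal.ofReal_toReal_rpow {e : ℝ≥0∞} (h0 : e ≠ 0) (ht : e ≠ ⊤) (p : ℝ) :
    ENNReal.ofReal (e.toReal ^ p) = e ^ p := by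
  rw [← ENNReal.ofReal_rpow_of_pos (ENNReal.toReal_pos h0 ht), ENNReal.ofReal_toReal ht]

lemma ENNReal.div_rpow_eq_mul_rpow_neg {x N : ℝ≥0∞} (hx : x ≠ 0) (hN' : N ≠ ⊤)
    (p : ℝ) : (N / x) ^ p = N ^ p * x ^ (-p) := by
  rw [div_eq_mul_inv, ENNReal.mul_rpow_of_ne_top hN' (ENNReal.inv_ne_top.2 hx),
    ENNReal.inv_rpow, ENNReal.rpow_neg]

/-- Choice of the optimal scale in the slice estimate. -/
lemma le_of_forall_scale {J x N g a b c : ℝ≥0∞} (hx' : x ≠ ⊤) (hN : N ≠ 0)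
    (hN' : N ≠ ⊤) (hx : x = 0 → J = 0)
    (h : ∀ ε : ℝ, 0 < ε → J ≤ x * (c * ENNReal.ofReal (ε ^ (1 / ((m : ℝ) + 1))) * a) +
      (g * (ENNReal.ofReal (ε ^ (-(m : ℝ) / (m + 1))) * b) +
        N * (ENNReal.ofReal (ε ^ (-(m : ℝ) / (m + 1))) * a))) :
    J ≤ (c + 1) * N ^ (1 / ((m : ℝ) + 1)) * (a * x ^ ((m : ℝ) / (m + 1))) +
      g * N ^ (-(m : ℝ) / (m + 1)) * (b * x ^ ((m : ℝ) / (m + 1))) := by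
  rcases eq_or_ne x 0 with h0 | h0
  · simp [hx h0]
  have e0 : N / x ≠ 0 := ENNReal.div_ne_zero.2 ⟨hN, hx'⟩
  have et : N / x ≠ ⊤ := ENNReal.div_ne_top hN' h0
  refine (h (N / x).toReal (ENNReal.toReal_pos e0 et)).trans (le_of_eq ?_)
  rw [ENNReal.ofReal_toReal_rpow e0 et, ENNReal.ofReal_toReal_rpow e0 et,
    ENNReal.div_rpow_eq_mul_rpow_neg h0 hN', ENNReal.div_rpow_eq_mul_rpow_neg h0 hN']
  have e1 : x * x ^ (-(1 / ((m : ℝ) + 1))) = x ^ ((m : ℝ) / (m + 1)) := by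
    conv_lhs => enter [1]; rw [← ENNReal.rpow_one x]
    rw [← ENNReal.rpow_add _ _ h0 hx']
    congr 1
    field_simp
    ring
  have e2 : N * N ^ (-(m : ℝ) / (m + 1)) = N ^ (1 / ((m : ℝ) + 1)) := by
    conv_lhs => enter [1]; rw [← ENNReal.rpow_one N]
    rw [← ENNReal.rpow_add _ _ hN hN']
    congr 1
    field_simp
    ring
  have e3 : -(-(m : ℝ) / (m + 1)) = m / (m + 1) := by ring
  rw [e3]
  calc _ = c * N ^ (1 / ((m : ℝ) + 1)) * (a * (x * x ^ (-(1 / ((m : ℝ) + 1))))) +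
        (g * N ^ (-(m : ℝ) / (m + 1)) * (b * x ^ ((m : ℝ) / (m + 1))) +
        (N * N ^ (-(m : ℝ) / (m + 1))) * (a * x ^ ((m : ℝ) / (m + 1)))) := by ring
    _ = _ := by rw [e1, e2]; ring

lemma lintegral_rpow_mul_le (hm : 1 ≤ m) {A x : ℝ → ℝ≥0∞} (hA : Measurable A)
    (hx : Measurable x) :
    ∫⁻ t, A t ^ (1 / ((m : ℝ) + 1)) * x t ^ ((m : ℝ) / (m + 1)) ≤
      (∫⁻ t, A t) ^ (1 / ((m : ℝ) + 1)) * (∫⁻ t, x t) ^ ((m : ℝ) / (m + 1)) := by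
  have hm0 : (0 : ℝ) < m := by exact_mod_cast hm
  have h := ENNReal.lintegral_mul_le_Lp_mul_Lq volume (holderConjugate_natCast_add_one hm)
    (f := fun t => A t ^ (1 / ((m : ℝ) + 1))) (g := fun t => x t ^ ((m : ℝ) / (m + 1)))
    (by fun_prop) (by fun_prop)
  have e1 : 1 / ((m : ℝ) + 1) * (m + 1) = 1 := by field_simp
  have e2 : (m : ℝ) / (m + 1) * ((m + 1) / m) = 1 := by field_simp
  simpa only [Pi.mul_apply, ← ENNReal.rpow_mul, e1, e2, ENNReal.rpow_one, one_div_div] using h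

theorem enorm_integral_mul_le_of_prodDiv (hm : 1 ≤ m) {F₀ : ℝ × (Fin m → ℝ) → ℝ}
    {F : Fin m → ℝ × (Fin m → ℝ) → ℝ}
    (hF₀ : ContDiff ℝ 1 F₀) (hF₀c : HasCompactSupport F₀)
    (hF : ∀ k, ContDiff ℝ 1 (F k)) (hFc : ∀ k, HasCompactSupport (F k))
    {Φ : ℝ × (Fin m → ℝ) → ℝ} (hΦ : ContDiff ℝ 1 Φ)
    {D : ℝ × (Fin m → ℝ) → ℝ≥0∞} (hDm : Measurable D)
    (hD : ∀ k p, ‖fderiv ℝ Φ p (0, Pi.single k 1)‖ₑ ≤ D p) :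
    ‖∫ p, F₀ p * Φ p‖ₑ ≤
      (m * (m + 1) + 1) * (((∫⁻ p, ‖F₀ p‖ₑ) + ∑ k, ∫⁻ p, ‖F k p‖ₑ) *
        (∫⁻ p, D p ^ ((m : ℝ) + 1)) ^ (1 / ((m : ℝ) + 1))) +
      (∫⁻ p, ‖prodDiv F₀ F p‖ₑ) *
        (∫⁻ p, ‖Φ p‖ₑ ^ ((m : ℝ) + 1)) ^ (1 / ((m : ℝ) + 1)) := by
  have mΦ : Measurable Φ := hΦ.continuous.measurable
  have mF₀ : Measurable F₀ := hF₀.continuous.measurable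
  have mF : ∀ k, Measurable (F k) := fun k => (hF k).continuous.measurable
  have mG : Measurable (prodDiv F₀ F) := by
    have h0 := continuous_fderiv_const_apply hF₀ (1, 0)
    have h1 := fun k => continuous_fderiv_const_apply (hF k) (0, Pi.single k 1)
    unfold prodDiv
    fun_prop
  have iF₀ : Integrable F₀ := hF₀.continuous.integrable_of_hasCompactSupport hF₀c
  have iF : ∀ k, Integrable (F k) := fun k =>
    (hF k).continuous.integrable_of_hasCompactSupport (hFc k)
  have iJ : Integrable (fun p => F₀ p * Φ p) :=
    (hF₀.continuous.mul hΦ.continuous).integrable_of_hasCompactSupport hF₀c.mul_right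
  set N : ℝ≥0∞ := (∫⁻ p, ‖F₀ p‖ₑ) + ∑ k, ∫⁻ p, ‖F k p‖ₑ with hNdef
  have hN' : N ≠ ⊤ := by
    refine ENNReal.add_ne_top.2 ⟨iF₀.2.ne, ?_⟩
    exact ENNReal.sum_ne_top.2 fun k _ => (iF k).2.ne
  rcases eq_or_ne N 0 with hN | hN
  · have h0 : ∫⁻ p, ‖F₀ p‖ₑ = 0 := by
      rw [hNdef, add_eq_zero] at hN
      exact hN.1
    rw [lintegral_eq_zero_iff (by fun_prop)] at h0
    have : ∫ p, F₀ p * Φ p = 0 := by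
      refine integral_eq_zero_of_ae ?_
      filter_upwards [h0] with p hp
      have : F₀ p = 0 := by simpa using hp
      simp [this]
    simp [this]
  have slice : ∀ {h : ℝ × (Fin m → ℝ) → ℝ≥0∞}, Measurable h →
      ∫⁻ p, h p = ∫⁻ t, ∫⁻ y, h (t, y) := fun hh => by
    rw [Measure.volume_eq_prod, lintegral_prod _ hh.aemeasurable]
  have hxN : ∫⁻ t, ∫⁻ y, ‖F₀ (t, y)‖ₑ ≤ N := by
    rw [← slice (h := fun p => ‖F₀ p‖ₑ) (by fun_prop)]
    exact le_self_add
  have hSN : ∫⁻ t, ∫⁻ y, ∑ k, ‖F k (t, y)‖ₑ ≤ N := by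
    rw [← slice (h := fun p => ∑ k, ‖F k p‖ₑ) (by fun_prop),
      lintegral_finsetSum _ (fun k _ => by fun_prop)]
    exact le_add_self
  set g : ℝ≥0∞ := ∫⁻ p, ‖prodDiv F₀ F p‖ₑ with hg
  have hg' : ∫⁻ s, ∫⁻ y, ‖prodDiv F₀ F (s, y)‖ₑ = g :=
    (slice (h := fun p => ‖prodDiv F₀ F p‖ₑ) (by fun_prop)).symm
  have key : ∀ t, ‖∫ y, F₀ (t, y) * Φ (t, y)‖ₑ ≤
      (m * (m + 1) + 1) * N ^ (1 / ((m : ℝ) + 1)) *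
        ((∫⁻ y, D (t, y) ^ ((m : ℝ) + 1)) ^ (1 / ((m : ℝ) + 1)) *
          (∫⁻ y, ‖F₀ (t, y)‖ₑ) ^ ((m : ℝ) / (m + 1))) +
      g * N ^ (-(m : ℝ) / (m + 1)) *
        ((∫⁻ y, ‖Φ (t, y)‖ₑ ^ ((m : ℝ) + 1)) ^ (1 / ((m : ℝ) + 1)) *
          (∫⁻ y, ‖F₀ (t, y)‖ₑ) ^ ((m : ℝ) / (m + 1))) := by
    intro t
    have hφ : ContDiff ℝ 1 fun y => Φ (t, y) := hΦ.comp (contDiff_prodMk_right t)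
    have it : Integrable fun y => F₀ (t, y) :=
      (hF₀.continuous.comp (by fun_prop)).integrable_of_hasCompactSupport
        (hF₀c.comp_prodMk_left t)
    refine le_of_forall_scale it.2.ne hN hN' ?_ ?_
    · intro h0
      rw [lintegral_eq_zero_iff (by fun_prop)] at h0
      rw [enorm_eq_zero]
      refine integral_eq_zero_of_ae ?_
      filter_upwards [h0] with y hy
      have : F₀ (t, y) = 0 := by simpa using hy
      simp [this]
    · intro ε hε
      refine (enorm_integral_slice_mul_le_of_scale hm hF₀ hF₀c hF hFc hφ
        (D := fun y => D (t, y)) (by fun_prop) (fun k y => ?_) t hε).trans ?_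
      · rw [fderiv_comp_prodMk_left hΦ]
        exact hD k _
      · rw [hg', ← mul_assoc (m : ℝ≥0∞)]
        gcongr
  have e1 : N ^ (1 / ((m : ℝ) + 1)) * N ^ ((m : ℝ) / (m + 1)) = N := by
    rw [← ENNReal.rpow_add _ _ hN hN']
    conv_rhs => rw [← ENNReal.rpow_one N]
    congr 1
    field_simp
    ring
  have e2 : N ^ (-(m : ℝ) / (m + 1)) * N ^ ((m : ℝ) / (m + 1)) = 1 := by
    rw [← ENNReal.rpow_add _ _ hN hN']
    conv_rhs => rw [← ENNReal.rpow_zero (x := N)]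
    congr 1
    ring
  have hfub : ∫ p, F₀ p * Φ p = ∫ t, ∫ y, F₀ (t, y) * Φ (t, y) := by
    rw [Measure.volume_eq_prod] at iJ ⊢
    exact integral_prod _ iJ
  calc ‖∫ p, F₀ p * Φ p‖ₑ ≤ ∫⁻ t, ‖∫ y, F₀ (t, y) * Φ (t, y)‖ₑ := by
        rw [hfub]
        exact enorm_integral_le_lintegral_enorm _
    _ ≤ _ := lintegral_mono key
    _ = (m * (m + 1) + 1) * N ^ (1 / ((m : ℝ) + 1)) *
        (∫⁻ t, (∫⁻ y, D (t, y) ^ ((m : ℝ) + 1)) ^ (1 / ((m : ℝ) + 1)) *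
          (∫⁻ y, ‖F₀ (t, y)‖ₑ) ^ ((m : ℝ) / (m + 1))) +
      g * N ^ (-(m : ℝ) / (m + 1)) *
        (∫⁻ t, (∫⁻ y, ‖Φ (t, y)‖ₑ ^ ((m : ℝ) + 1)) ^ (1 / ((m : ℝ) + 1)) *
          (∫⁻ y, ‖F₀ (t, y)‖ₑ) ^ ((m : ℝ) / (m + 1))) := by
        rw [lintegral_add_left (by fun_prop), lintegral_const_mul _ (by fun_prop),
          lintegral_const_mul _ (by fun_prop)]
    _ ≤ (m * (m + 1) + 1) * N ^ (1 / ((m : ℝ) + 1)) *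
        ((∫⁻ t, ∫⁻ y, D (t, y) ^ ((m : ℝ) + 1)) ^ (1 / ((m : ℝ) + 1)) *
          N ^ ((m : ℝ) / (m + 1))) +
      g * N ^ (-(m : ℝ) / (m + 1)) *
        ((∫⁻ t, ∫⁻ y, ‖Φ (t, y)‖ₑ ^ ((m : ℝ) + 1)) ^ (1 / ((m : ℝ) + 1)) *
          N ^ ((m : ℝ) / (m + 1))) := by
        gcongr
        · refine (lintegral_rpow_mul_le hm (by fun_prop) (by fun_prop)).trans ?_
          gcongr
        · refine (lintegral_rpow_mul_le hm (by fun_prop) (by fun_prop)).trans ?_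
          gcongr
    _ = (m * (m + 1) + 1) * ((N ^ (1 / ((m : ℝ) + 1)) * N ^ ((m : ℝ) / (m + 1))) *
          (∫⁻ t, ∫⁻ y, D (t, y) ^ ((m : ℝ) + 1)) ^ (1 / ((m : ℝ) + 1))) +
        g * ((∫⁻ t, ∫⁻ y, ‖Φ (t, y)‖ₑ ^ ((m : ℝ) + 1)) ^ (1 / ((m : ℝ) + 1)) *
          (N ^ (-(m : ℝ) / (m + 1)) * N ^ ((m : ℝ) / (m + 1)))) := by ring
    _ = _ := by
        rw [e1, e2, mul_one, slice (h := fun p => D p ^ ((m : ℝ) + 1)) (by fun_prop),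
          slice (h := fun p => ‖Φ p‖ₑ ^ ((m : ℝ) + 1)) (by fun_prop)]

end Optimization

section Transfer

variable {m : ℕ}

/-- The identification of `ℝ × ℝᵐ` with `ℝᵐ⁺¹`. -/
def consL (m : ℕ) : (ℝ × (Fin m → ℝ)) ≃L[ℝ] (Fin (m + 1) → ℝ) :=
  Fin.consEquivL ℝ (fun _ : Fin (m + 1) => ℝ)

lemma measurePreserving_consL (m : ℕ) : MeasurePreserving (consL m) volume volume := by
  have h := (volume_preserving_piFinSuccAbove (fun _ : Fin (m + 1) => ℝ) 0).symm
  have e : ⇑(consL m) = (MeasurableEquiv.piFinSuccAbove (fun _ : Fin (m + 1) => ℝ) 0).symm := by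
    ext p i
    refine Fin.cases ?_ (fun j => ?_) i <;> simp [consL, MeasurableEquiv.piFinSuccAbove]
  rwa [e]

lemma measurableEmbedding_consL (m : ℕ) : MeasurableEmbedding (consL m) :=
  (consL m).toHomeomorph.measurableEmbedding

lemma consL_one_zero : consL m (1, 0) = Pi.single 0 1 := by
  ext i
  refine Fin.cases ?_ (fun j => ?_) i <;> simp [consL]

lemma consL_zero_single (k : Fin m) : consL m (0, Pi.single k 1) = Pi.single k.succ 1 := by
  ext i
  refine Fin.cases ?_ (fun j => ?_) i <;> simp [consL, Pi.single_apply]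

lemma fderiv_comp_consL {f : (Fin (m + 1) → ℝ) → ℝ} (p v : ℝ × (Fin m → ℝ)) :
    fderiv ℝ (fun p => f (consL m p)) p v = fderiv ℝ f (consL m p) (consL m v) := by
  have h := (consL m).comp_right_fderiv (f := f) (x := p)
  simp only [Function.comp_def] at h
  rw [h]
  simp

lemma ofReal_integral_abs {X : Type*} [MeasurableSpace X] {μ : Measure X} {f : X → ℝ}
    (hf : Integrable f μ) : ENNReal.ofReal (∫ x, |f x| ∂μ) = ∫⁻ x, ‖f x‖ₑ ∂μ :=
  ofReal_integral_norm_eq_lintegral_enorm hf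

lemma ofReal_lpNormEuc {n : ℕ} {p : ℝ} (hp : 0 < p) {f : (Fin n → ℝ) → ℝ}
    (hf : Continuous f) (hfc : HasCompactSupport f) :
    ENNReal.ofReal (lpNormEuc p f) = (∫⁻ x, ‖f x‖ₑ ^ p) ^ (1 / p) := by
  have hi : Integrable fun x => |f x| ^ p := by
    refine Continuous.integrable_of_hasCompactSupport
      (hf.abs.rpow_const fun _ => Or.inr hp.le) ?_
    exact hfc.comp_left (g := fun u : ℝ => |u| ^ p) (by simp [Real.zero_rpow hp.ne'])
  rw [lpNormEuc, ← ENNReal.ofReal_rpow_of_nonneg (integral_nonneg fun x => by positivity)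
    (by positivity), ofReal_integral_eq_lintegral_ofReal hi
      (Filter.Eventually.of_forall fun x => by positivity)]
  congr 2 with x
  rw [← ENNReal.ofReal_rpow_of_nonneg (abs_nonneg _) hp.le, ← Real.enorm_eq_ofReal_abs]

lemma lpNormEuc_nonneg {n : ℕ} (p : ℝ) (f : (Fin n → ℝ) → ℝ) : 0 ≤ lpNormEuc p f :=
  Real.rpow_nonneg (integral_nonneg fun x => by positivity) _

end Transfer

/-- the Bourgain–Brezis / Van Schaftingen `L¹` duality inequality on
`ℝⁿ`: if `div f = g` then `|∫ f₁ Φ| ≤ C (‖f‖_{L¹} ‖∇Φ‖_{Lⁿ} + ‖g‖_{L¹} ‖Φ‖_{Lⁿ})`. -/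
theorem div_curl_duality_euclidean (n : ℕ) (hn : 2 ≤ n) :
    ∃ C : ℝ, 0 < C ∧
      ∀ f : Fin n → (Fin n → ℝ) → ℝ,
        (∀ k, ContDiff ℝ (⊤ : ℕ∞) (f k) ∧ HasCompactSupport (f k)) →
        ∀ Φ : (Fin n → ℝ) → ℝ, ContDiff ℝ (⊤ : ℕ∞) Φ → HasCompactSupport Φ →
          |∫ x : Fin n → ℝ, f ⟨0, by omega⟩ x * Φ x| ≤
            C * ((∑ k, ∫ x : Fin n → ℝ, |f k x|) *
                    lpNormEuc n (fun x =>
                      Real.sqrt (∑ k, (fderiv ℝ Φ x (Pi.single k 1)) ^ 2)) +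
                 (∫ x : Fin n → ℝ, |∑ k, fderiv ℝ (f k) x (Pi.single k 1)|) *
                    lpNormEuc n Φ) := by
  obtain ⟨m, rfl⟩ : ∃ m, n = m + 1 := ⟨n - 1, by omega⟩
  have hm : 1 ≤ m := by omega
  refine ⟨m * (m + 1) + 1, by positivity, fun f hf Φ hΦ hΦc => ?_⟩
  change |∫ x, f 0 x * Φ x| ≤ _
  have f1 : ∀ k, ContDiff ℝ 1 (f k) := fun k => (hf k).1.of_le (by exact_mod_cast le_top)
  have Φ1 : ContDiff ℝ 1 Φ := hΦ.of_le (by exact_mod_cast le_top)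
  have cL : ContDiff ℝ 1 (consL m) := (consL m).contDiff
  have hcs : ∀ {h : (Fin (m + 1) → ℝ) → ℝ}, HasCompactSupport h →
      HasCompactSupport fun p => h (consL m p) := fun hh =>
    hh.comp_homeomorph (consL m).toHomeomorph
  have fi : ∀ k, Integrable (f k) := fun k =>
    (f1 k).continuous.integrable_of_hasCompactSupport (hf k).2
  have dΦ : ∀ k, Continuous fun x => fderiv ℝ Φ x (Pi.single k 1) := fun k =>
    continuous_fderiv_const_apply Φ1 _
  set gradΦ : (Fin (m + 1) → ℝ) → ℝ := fun x =>
    Real.sqrt (∑ k, (fderiv ℝ Φ x (Pi.single k 1)) ^ 2) with hgrad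
  set g : (Fin (m + 1) → ℝ) → ℝ := fun x => ∑ k, fderiv ℝ (f k) x (Pi.single k 1) with hg
  have gradc : Continuous gradΦ := by fun_prop
  have gradcs : HasCompactSupport gradΦ := by
    refine HasCompactSupport.intro (hΦc.fderiv (𝕜 := ℝ)).isCompact fun x hx => ?_
    simp [hgrad, image_eq_zero_of_notMem_tsupport hx]
  have gi : Integrable g := integrable_finsetSum _ fun k _ =>
    (continuous_fderiv_const_apply (f1 k) _).integrable_of_hasCompactSupport
      ((hf k).2.fderiv_apply (𝕜 := ℝ) _)
  have gradle : ∀ k x, ‖fderiv ℝ Φ x (Pi.single k 1)‖ₑ ≤ ‖gradΦ x‖ₑ := by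
    intro k x
    rw [enorm_le_iff_norm_le, Real.norm_eq_abs, Real.norm_eq_abs]
    refine (Real.abs_le_sqrt ?_).trans (le_abs_self _)
    exact Finset.single_le_sum (f := fun k => (fderiv ℝ Φ x (Pi.single k 1)) ^ 2)
      (fun _ _ => sq_nonneg _) (Finset.mem_univ k)
  have main := enorm_integral_mul_le_of_prodDiv hm
    (F₀ := fun p => f 0 (consL m p)) (F := fun k p => f k.succ (consL m p))
    ((f1 0).comp cL) (hcs (hf 0).2) (fun k => (f1 k.succ).comp cL) (fun k => hcs (hf k.succ).2)
    (Φ := fun p => Φ (consL m p)) (Φ1.comp cL)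
    (D := fun p => ‖gradΦ (consL m p)‖ₑ)
    (by have := (consL m).continuous.measurable; fun_prop)
    (fun k p => by rw [fderiv_comp_consL, consL_zero_single]; exact gradle _ _)
  have hdiv : ∀ p, prodDiv (fun p => f 0 (consL m p)) (fun k p => f k.succ (consL m p)) p =
      g (consL m p) := by
    intro p
    simp only [prodDiv, fderiv_comp_consL, consL_one_zero, consL_zero_single, hg]
    rw [Fin.sum_univ_succ]
  have tr : ∀ h : (Fin (m + 1) → ℝ) → ℝ≥0∞, ∫⁻ p, h (consL m p) = ∫⁻ x, h x := fun h =>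
    (measurePreserving_consL m).lintegral_comp_emb (measurableEmbedding_consL m) h
  simp only [hdiv] at main
  rw [(measurePreserving_consL m).integral_comp (measurableEmbedding_consL m)
      (fun x => f 0 x * Φ x), tr fun x => ‖f 0 x‖ₑ, tr fun x => ‖gradΦ x‖ₑ ^ ((m : ℝ) + 1),
    tr fun x => ‖g x‖ₑ, tr fun x => ‖Φ x‖ₑ ^ ((m : ℝ) + 1)] at main
  simp only [fun k : Fin m => tr fun x => ‖f k.succ x‖ₑ] at main
  rw [← Fin.sum_univ_succ (f := fun k => ∫⁻ x, ‖f k x‖ₑ)] at main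
  have hp : (0 : ℝ) < (m : ℝ) + 1 := by positivity
  rw [← ofReal_lpNormEuc hp gradc gradcs, ← ofReal_lpNormEuc hp Φ1.continuous hΦc,
    ← ofReal_integral_abs gi] at main
  simp only [← ofReal_integral_abs (fi _)] at main
  have hC : ((m : ℝ≥0∞) * (m + 1) + 1) = ENNReal.ofReal ((m : ℝ) * (m + 1) + 1) := by
    have := ENNReal.ofReal_natCast (m * (m + 1) + 1)
    push_cast at this
    exact this.symm
  have hS : 0 ≤ ∑ k, ∫ x, |f k x| :=
    Finset.sum_nonneg fun k _ => integral_nonneg fun x => abs_nonneg _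
  have hg0 : 0 ≤ ∫ x, |g x| := integral_nonneg fun x => abs_nonneg _
  have hn1 := lpNormEuc_nonneg ((m : ℝ) + 1) gradΦ
  have hn2 := lpNormEuc_nonneg ((m : ℝ) + 1) Φ
  rw [hC, ← ENNReal.ofReal_sum_of_nonneg (fun k _ => integral_nonneg fun x => abs_nonneg _),
    ← ENNReal.ofReal_mul hS, ← ENNReal.ofReal_mul (by positivity), ← ENNReal.ofReal_mul hg0,
    ← ENNReal.ofReal_add (by positivity) (by positivity), Real.enorm_eq_ofReal_abs,
    ENNReal.ofReal_le_ofReal_iff (by positivity)] at main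
  push_cast
  have hC1 : (1 : ℝ) ≤ m * (m + 1) + 1 := by nlinarith [Nat.cast_nonneg (α := ℝ) m]
  have hle := le_mul_of_one_le_left (mul_nonneg hg0 hn2) hC1
  linarith
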